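/- arXiv:2503.23158 — 4 statements merged into one kernel-verified Lean document; each statement's English description precedes it below -/
import Mathlib

section
/- Let $K \in \mathbb{R}^{n\times n}$ be symmetric, $k \in \mathbb{R}^n$, $\kappa \in \mathbb{R}$, with $K^+ = \begin{pmatrix} K & k \\ k^T & \kappa \end{pmatrix}$ symmetric positive definite, and set $s = \kappa - k^T K^{-1} k$. Let $\mathcal{X} = [0,1]^d$ with Lebesgue measure, and let $c : \mathcal{X} \to \mathbb{R}$, $u : \mathcal{X} \to \mathbb{R}^n$, $v : \mathcal{X} \to \mathbb{R}$ be measurable functions such that $x \mapsto c(x) - u(x)^T K^{-1} u(x)$ and $x \mapsto (v(x) - k^T K^{-1} u(x))^2$ are Lebesgue integrable on $\mathcal{X}$. Define $I_n = \int_{\mathcal{X}} \big(c(x) - u(x)^T K^{-1} u(x)\big)\,dx$ and $I_{n+1} = \int_{\mathcal{X}} \big(c(x) - (u(x),v(x))^T (K^+)^{-1} (u(x),v(x))\big)\,dx$. Then $I_{n+1} = I_n - R_{n+1}$, where $R_{n+1} = \frac{1}{s}\int_{\mathcal{X}} \big(v(x) - k^T K^{-1} u(x)\big)^2 dx$. 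-/
open Matrix MeasureTheory

section BorderedMatrix

variable {m F : Type*}

/-- The square matrix `K` bordered by the vector `k` on both sides, with corner entry `κ`. -/
def Matrix.bordered (K : Matrix m m F) (k : m → F) (κ : F) : Matrix (m ⊕ Unit) (m ⊕ Unit) F :=
  fromBlocks K (replicateCol Unit k) (replicateRow Unit k) (of fun _ _ => κ)

variable [Fintype m] [Field F]

/-- A bordered matrix acts on a vector blockwise. -/
theorem Matrix.bordered_mulVec_sumElim (K : Matrix m m F) (k : m → F) (κ : F) (w : m → F) (t : F) :
    bordered K k κ *ᵥ Sum.elim w (fun _ => t) =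
      Sum.elim (K *ᵥ w + t • k) (fun _ => k ⬝ᵥ w + κ * t) := by
  ext i
  cases i <;> simp [bordered, mulVec, dotProduct, mul_comm]

variable [DecidableEq m]

/-- The Schur complement of an invertible block in an invertible bordered matrix is nonzero. -/
theorem Matrix.bordered_schur_ne_zero {K : Matrix m m F} (k : m → F) (κ : F) (hK : IsUnit K.det)
    (hdet : IsUnit (bordered K k κ).det) :
    κ - k ⬝ᵥ (K⁻¹ *ᵥ k) ≠ 0 := by
  intro h
  have hker := bordered_mulVec_sumElim K k κ (-(K⁻¹ *ᵥ k)) 1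
  have hzero : Sum.elim (K *ᵥ (-(K⁻¹ *ᵥ k)) + (1 : F) • k)
      (fun _ : Unit => k ⬝ᵥ (-(K⁻¹ *ᵥ k)) + κ * 1) = 0 := by
    ext i
    cases i with
    | inl i => simp [mulVec_neg, mulVec_mulVec, mul_nonsing_inv K hK]
    | inr i =>
      simp only [Sum.elim_inr, dotProduct_neg, Pi.zero_apply]
      linear_combination h
  rw [hzero] at hker
  have hvec := eq_zero_of_mulVec_eq_zero hdet.ne_zero hker
  simpa using congrFun hvec (Sum.inr ())

/-- The inverse quadratic form of a bordered symmetric matrix exceeds that of its leading block by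
the squared residual divided by the Schur complement. -/
theorem Matrix.IsSymm.bordered_inv_quadraticForm {K : Matrix m m F} (hsymm : K.IsSymm)
    (k : m → F) (κ : F) (hK : IsUnit K.det) (hdet : IsUnit (bordered K k κ).det)
    (u : m → F) (v : F) :
    Sum.elim u (fun _ => v) ⬝ᵥ ((bordered K k κ)⁻¹ *ᵥ Sum.elim u (fun _ => v)) =
      u ⬝ᵥ (K⁻¹ *ᵥ u) +
        1 / (κ - k ⬝ᵥ (K⁻¹ *ᵥ k)) * (v - k ⬝ᵥ (K⁻¹ *ᵥ u)) ^ 2 := by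
  have hs := bordered_schur_ne_zero k κ hK hdet
  have hcomm : u ⬝ᵥ (K⁻¹ *ᵥ k) = k ⬝ᵥ (K⁻¹ *ᵥ u) := by
    rw [dotProduct_mulVec, ← mulVec_transpose, transpose_nonsing_inv, hsymm.eq, dotProduct_comm]
  set s := κ - k ⬝ᵥ (K⁻¹ *ᵥ k) with hs_def
  set t := (v - k ⬝ᵥ (K⁻¹ *ᵥ u)) / s with ht_def
  have hts : t * s = v - k ⬝ᵥ (K⁻¹ *ᵥ u) := div_mul_cancel₀ _ hs
  have hsolve :
      bordered K k κ *ᵥ Sum.elim (K⁻¹ *ᵥ u - t • (K⁻¹ *ᵥ k)) (fun _ => t) =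
        Sum.elim u (fun _ => v) := by
    rw [bordered_mulVec_sumElim]
    congr 1
    · simp [mulVec_sub, mulVec_smul, mulVec_mulVec, mul_nonsing_inv K hK]
    · funext _
      rw [dotProduct_sub, dotProduct_smul, smul_eq_mul]
      linear_combination hts + t * hs_def
  have hinv :
      (bordered K k κ)⁻¹ *ᵥ Sum.elim u (fun _ => v) =
        Sum.elim (K⁻¹ *ᵥ u - t • (K⁻¹ *ᵥ k)) (fun _ => t) := by
    rw [← hsolve, mulVec_mulVec, nonsing_inv_mul _ hdet, one_mulVec]
  rw [hinv, sumElim_dotProduct_sumElim, dotProduct_sub, dotProduct_smul, hcomm, smul_eq_mul]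
  have hunit : (fun _ : Unit => v) ⬝ᵥ (fun _ => t) = v * t := by simp [dotProduct]
  rw [hunit, ht_def]
  ring

end BorderedMatrix

/-- **Sequential IMSPE identity (Theorem 1, no-trend core).**
With `K⁺` the augmented covariance matrix and `s = κ - kᵀK⁻¹k` its Schur complement, the IMSPE
after `n+1` design points equals the IMSPE after `n` design points minus the reduction
`R_{n+1} = (1/s) ∫ (v(x) - kᵀK⁻¹u(x))² dx` over the input space `𝒳 = [0,1]^d`. -/
theorem imspe_sequential_reduction
    (n d : ℕ) (K : Matrix (Fin n) (Fin n) ℝ) (k : Fin n → ℝ) (κ : ℝ)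
    (hK : K.IsSymm)
    (Kplus : Matrix (Fin n ⊕ Unit) (Fin n ⊕ Unit) ℝ)
    (hKplus : Kplus = Matrix.fromBlocks K (fun i _ => k i) (fun _ j => k j) (fun _ _ => κ))
    (hpd : Kplus.PosDef)
    (s : ℝ) (hs : s = κ - k ⬝ᵥ (K⁻¹ *ᵥ k))
    (c : (Fin d → ℝ) → ℝ) (u : (Fin d → ℝ) → (Fin n → ℝ)) (v : (Fin d → ℝ) → ℝ)
    (hc : Measurable c) (hu : Measurable u) (hv : Measurable v)
    (hint1 : IntegrableOn (fun x => c x - u x ⬝ᵥ (K⁻¹ *ᵥ u x))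
      (Set.Icc (0 : Fin d → ℝ) 1) volume)
    (hint2 : IntegrableOn (fun x => (v x - k ⬝ᵥ (K⁻¹ *ᵥ u x)) ^ 2)
      (Set.Icc (0 : Fin d → ℝ) 1) volume) :
    (∫ x in Set.Icc (0 : Fin d → ℝ) 1,
        (c x - (Sum.elim (u x) (fun _ => v x)) ⬝ᵥ (Kplus⁻¹ *ᵥ (Sum.elim (u x) (fun _ => v x))))) =
      (∫ x in Set.Icc (0 : Fin d → ℝ) 1, (c x - u x ⬝ᵥ (K⁻¹ *ᵥ u x))) -
        (1 / s) * ∫ x in Set.Icc (0 : Fin d → ℝ) 1, (v x - k ⬝ᵥ (K⁻¹ *ᵥ u x)) ^ 2 := by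
  subst hs
  have hbordered : Kplus = bordered K k κ := hKplus
  subst hbordered
  have hdet := hpd.det_pos.ne'.isUnit
  have hKpd : K.PosDef := hpd.submatrix Sum.inl_injective
  have hKdet := hKpd.det_pos.ne'.isUnit
  rw [← integral_const_mul, ← integral_sub hint1 (hint2.const_mul _)]
  simp_rw [hK.bordered_inv_quadraticForm k κ hKdet hdet, sub_add_eq_sub_sub]
end

section
/- Let $m=1$, $a > 0$, $l > 0$, and $\gamma \in (\tfrac12, 1)$. For all $0 \le t_1 \le t_2 \le t_3 \le t_4$, the increments of a centered Gaussian process with covariance $K_{\gamma}$ over the disjoint intervals $[t_1,t_2]$ and $[t_3,t_4]$ are nonnegatively correlated: $K_{\gamma}(t_2,t_4) - K_{\gamma}(t_2,t_3) - K_{\gamma}(t_1,t_4) + K_{\gamma}(t_1,t_3) \ge 0$. -/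
/-- The one-dimensional (`m = 1`) adaptive (lifted-Brownian-type) kernel on fidelity
parameters `t1, t2 ∈ [0,∞)`. -/
noncomputable def Kgamma1 (γ a l : ℝ) (t1 t2 : ℝ) : ℝ :=
  (1 / 2) * (a * t1 ^ l + a * t2 ^ l -
    (a ^ (1 / γ) * (t1 ^ (l / (2 * γ)) - t2 ^ (l / (2 * γ))) ^ 2) ^ γ)

theorem ConvexOn.map_add_map_le_of_add_eq_add {s : Set ℝ} {f : ℝ → ℝ} (hf : ConvexOn ℝ s f)
    {x y b c : ℝ} (hx : x ∈ s) (hy : y ∈ s) (hxb : x ≤ b) (hby : b ≤ y) (h : b + c = x + y) :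
    f b + f c ≤ f x + f y := by
  have hb : b ∈ segment ℝ x y := by
    rw [segment_eq_Icc (hxb.trans hby)]
    exact ⟨hxb, hby⟩
  obtain ⟨p, q, hp, hq, hpq, rfl⟩ := hb
  have hc : c = q • x + p • y := by
    simp only [smul_eq_mul] at h ⊢
    linear_combination h - (x + y) * hpq
  have h₁ := hf.2 hx hy hp hq hpq
  have h₂ := hf.2 hx hy hq hp (by rw [add_comm, hpq])
  rw [hc]
  simp only [smul_eq_mul] at h₁ h₂ ⊢
  linear_combination h₁ + h₂ + (f x + f y) * hpq

theorem Kgamma1_eq_of_le {γ a l s t : ℝ} (hγ : 0 < γ) (ha : 0 < a) (hl : 0 < l)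
    (hs : 0 ≤ s) (hst : s ≤ t) :
    Kgamma1 γ a l s t = (1 / 2) * (a * s ^ l + a * t ^ l -
      a * (t ^ (l / (2 * γ)) - s ^ (l / (2 * γ))) ^ (2 * γ)) := by
  have hu : 0 ≤ t ^ (l / (2 * γ)) - s ^ (l / (2 * γ)) :=
    sub_nonneg.2 (Real.rpow_le_rpow hs hst (by positivity))
  rw [Kgamma1, sub_sq_comm, Real.mul_rpow (by positivity) (by positivity), ← Real.rpow_mul ha.le,
    one_div_mul_cancel hγ.ne', Real.rpow_one, ← Real.rpow_natCast, ← Real.rpow_mul hu]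
  norm_num

/-- **Nonnegatively correlated increments for `γ ∈ (1/2, 1)`.** For `0 ≤ t₁ ≤ t₂ ≤ t₃ ≤ t₄`,
the increments of a centered Gaussian process with covariance `K_γ` over the disjoint intervals
`[t₁,t₂]` and `[t₃,t₄]` have nonnegative covariance
`K(t₂,t₄) - K(t₂,t₃) - K(t₁,t₄) + K(t₁,t₃) ≥ 0`. -/
theorem Kgamma1_increments_nonneg_corr (γ a l : ℝ)
    (hγ : γ ∈ Set.Ioo (1 / 2 : ℝ) 1) (ha : 0 < a) (hl : 0 < l)
    (t1 t2 t3 t4 : ℝ) (h1 : 0 ≤ t1) (h12 : t1 ≤ t2) (h23 : t2 ≤ t3) (h34 : t3 ≤ t4) :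
    0 ≤ Kgamma1 γ a l t2 t4 - Kgamma1 γ a l t2 t3 -
      Kgamma1 γ a l t1 t4 + Kgamma1 γ a l t1 t3 := by
  obtain ⟨hγ₁, -⟩ := hγ
  have hγ₀ : 0 < γ := by linarith
  have hmono {s t : ℝ} (hs : 0 ≤ s) (hst : s ≤ t) : s ^ (l / (2 * γ)) ≤ t ^ (l / (2 * γ)) :=
    Real.rpow_le_rpow hs hst (by positivity)
  have h2 := h1.trans h12
  have h3 := h2.trans h23
  rw [Kgamma1_eq_of_le hγ₀ ha hl h2 (h23.trans h34), Kgamma1_eq_of_le hγ₀ ha hl h2 h23,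
    Kgamma1_eq_of_le hγ₀ ha hl h1 (h12.trans (h23.trans h34)),
    Kgamma1_eq_of_le hγ₀ ha hl h1 (h12.trans h23)]
  have u12 := hmono h1 h12
  have u23 := hmono h2 h23
  have u34 := hmono h3 h34
  generalize t1 ^ (l / (2 * γ)) = u1 at *
  generalize t2 ^ (l / (2 * γ)) = u2 at *
  generalize t3 ^ (l / (2 * γ)) = u3 at *
  generalize t4 ^ (l / (2 * γ)) = u4 at *
  have key := (convexOn_rpow (p := 2 * γ) (by linarith)).map_add_map_le_of_add_eq_add
    (x := u3 - u2) (y := u4 - u1) (b := u4 - u2) (c := u3 - u1)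
    (Set.mem_Ici.2 (by linarith)) (Set.mem_Ici.2 (by linarith)) (by linarith) (by linarith)
    (by ring)
  linear_combination (a / 2) * key
end

section
/- Let $m=1$, $a > 0$, $l > 0$, and $\gamma \in (0, \tfrac12)$. For all $0 \le t_1 \le t_2 \le t_3 \le t_4$, the increments of a centered Gaussian process with covariance $K_{\gamma}$ over the disjoint intervals $[t_1,t_2]$ and $[t_3,t_4]$ are nonpositively correlated: $K_{\gamma}(t_2,t_4) - K_{\gamma}(t_2,t_3) - K_{\gamma}(t_1,t_4) + K_{\gamma}(t_1,t_3) \le 0$. -/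
/-- Four-point inequality for a concave function on `[0,∞)`. -/
theorem ConcaveOn.add_le_add_of_nonneg {f : ℝ → ℝ} (hf : ConcaveOn ℝ (Set.Ici 0) f)
    {x u v : ℝ} (hx : 0 ≤ x) (hu : 0 ≤ u) (hv : 0 ≤ v) :
    f x + f (x + u + v) ≤ f (x + u) + f (x + v) := by
  rcases (add_nonneg hu hv).eq_or_lt with h | h
  · obtain rfl : u = 0 := by linarith
    obtain rfl : v = 0 := by linarith
    simp
  · have hne : u + v ≠ 0 := h.ne'
    have hy : x + u + v ∈ Set.Ici (0 : ℝ) := by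
      simp only [Set.mem_Ici]
      positivity
    have hu' : 0 ≤ u / (u + v) := by positivity
    have hv' : 0 ≤ v / (u + v) := by positivity
    have hsum : v / (u + v) + u / (u + v) = 1 := by
      field_simp
      ring
    have hsum' : u / (u + v) + v / (u + v) = 1 := by
      field_simp
    have e₁ := hf.2 (Set.mem_Ici.2 hx) hy hv' hu' hsum
    have e₂ := hf.2 (Set.mem_Ici.2 hx) hy hu' hv' hsum'
    have p₁ : (v / (u + v)) • x + (u / (u + v)) • (x + u + v) = x + u := by
      simp only [smul_eq_mul]
      field_simp
      ring
    have p₂ : (u / (u + v)) • x + (v / (u + v)) • (x + u + v) = x + v := by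
      simp only [smul_eq_mul]
      field_simp
      ring
    rw [p₁] at e₁
    rw [p₂] at e₂
    simp only [smul_eq_mul] at e₁ e₂
    linear_combination e₁ + e₂ - (f x + f (x + u + v)) * hsum

/-- The increment term of `Kgamma1` is a power of the distance, with exponent `2 * γ`. -/
theorem rpow_one_div_mul_sub_sq_rpow {γ a x y : ℝ} (hγ : 0 < γ) (ha : 0 < a) (hxy : x ≤ y) :
    (a ^ (1 / γ) * (x - y) ^ 2) ^ γ = a * (y - x) ^ (2 * γ) := by
  have h : 0 ≤ y - x := sub_nonneg.2 hxy
  rw [Real.mul_rpow (by positivity) (by positivity), ← Real.rpow_mul ha.le,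
    one_div_mul_cancel hγ.ne', Real.rpow_one, Real.rpow_mul h, Real.rpow_two, sub_sq_comm]

/-- **Nonpositively correlated increments for `γ ∈ (0, 1/2)`.** For `0 ≤ t₁ ≤ t₂ ≤ t₃ ≤ t₄`,
the increments of a centered Gaussian process with covariance `K_γ` over the disjoint intervals
`[t₁,t₂]` and `[t₃,t₄]` have nonpositive covariance
`K(t₂,t₄) - K(t₂,t₃) - K(t₁,t₄) + K(t₁,t₃) ≤ 0`. -/
theorem Kgamma1_increments_nonpos_corr (γ a l : ℝ)
    (hγ : γ ∈ Set.Ioo (0 : ℝ) (1 / 2)) (ha : 0 < a) (hl : 0 < l)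
    (t1 t2 t3 t4 : ℝ) (h1 : 0 ≤ t1) (h12 : t1 ≤ t2) (h23 : t2 ≤ t3) (h34 : t3 ≤ t4) :
    Kgamma1 γ a l t2 t4 - Kgamma1 γ a l t2 t3 -
      Kgamma1 γ a l t1 t4 + Kgamma1 γ a l t1 t3 ≤ 0 := by
  obtain ⟨hγ0, hγ1⟩ := hγ
  have hq : 0 ≤ l / (2 * γ) := by positivity
  have h2 : 0 ≤ t2 := h1.trans h12
  have s12 := Real.rpow_le_rpow h1 h12 hq
  have s23 := Real.rpow_le_rpow h2 h23 hq
  have s34 := Real.rpow_le_rpow (h2.trans h23) h34 hq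
  simp only [Kgamma1]
  rw [rpow_one_div_mul_sub_sq_rpow hγ0 ha (s23.trans s34),
    rpow_one_div_mul_sub_sq_rpow hγ0 ha s23,
    rpow_one_div_mul_sub_sq_rpow hγ0 ha (s12.trans (s23.trans s34)),
    rpow_one_div_mul_sub_sq_rpow hγ0 ha (s12.trans s23)]
  generalize t1 ^ (l / (2 * γ)) = x1 at *
  generalize t2 ^ (l / (2 * γ)) = x2 at *
  generalize t3 ^ (l / (2 * γ)) = x3 at *
  generalize t4 ^ (l / (2 * γ)) = x4 at *
  have key := (Real.concaveOn_rpow (p := 2 * γ) (by linarith) (by linarith)).add_le_add_of_nonneg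
    (sub_nonneg.2 s23) (sub_nonneg.2 s34) (sub_nonneg.2 s12)
  rw [show x3 - x2 + (x4 - x3) + (x2 - x1) = x4 - x1 by ring,
    show x3 - x2 + (x4 - x3) = x4 - x2 by ring,
    show x3 - x2 + (x2 - x1) = x3 - x1 by ring] at key
  linear_combination (1 / 2) * mul_le_mul_of_nonneg_left key ha.le
end

section
/- Let $\gamma \in (0,1)$, $a_1,\dots,a_m > 0$, and $l_1,\dots,l_m > 0$. For any fidelity parameters $\mathbf{t}^1, \dots, \mathbf{t}^n \in [0,\infty)^m$, the $n \times n$ matrix with entries $K_{\gamma}(\mathbf{t}^i, \mathbf{t}^j)$ is positive semidefinite; that is, $K_\gamma$ is a valid covariance function on $[0,\infty)^m$. -/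
/-- The adaptive (lifted-Brownian-type) kernel on fidelity parameters in `[0,∞)^m`. -/
noncomputable def Kgamma (m : ℕ) (γ : ℝ) (a l : Fin m → ℝ) (t1 t2 : Fin m → ℝ) : ℝ :=
  (1 / 2) *
    ((∑ j, (a j * t1 j ^ l j) ^ (1 / γ)) ^ γ +
      (∑ j, (a j * t2 j ^ l j) ^ (1 / γ)) ^ γ -
      (∑ j, (a j) ^ (1 / γ) * (t1 j ^ (l j / (2 * γ)) - t2 j ^ (l j / (2 * γ))) ^ 2) ^ γ)

open MeasureTheory Set Matrix

namespace Matrix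

variable {ι : Type*}

theorem PosSemidef.map_pow_succ {A : Matrix ι ι ℝ} (hA : A.PosSemidef) (k : ℕ) :
    (A.map (· ^ (k + 1))).PosSemidef := by
  induction k with
  | zero => simpa using hA
  | succ k ih =>
    have h : A.map (· ^ (k + 1 + 1)) = A.map (· ^ (k + 1)) ⊙ A := by
      ext i j
      simp [pow_succ]
    rw [h]
    exact ih.hadamard hA

variable [Fintype ι]

theorem posSemidef_real_iff_sum {M : Matrix ι ι ℝ} :
    M.PosSemidef ↔ (∀ i j, M i j = M j i) ∧ ∀ x : ι → ℝ, 0 ≤ ∑ i, ∑ j, x i * M i j * x j := by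
  rw [posSemidef_iff_dotProduct_mulVec]
  refine and_congr ⟨fun h i j => ?_, fun h => ?_⟩ (forall_congr' fun x => ?_)
  · simpa using h.apply j i
  · ext i j
    simpa using h j i
  · simp [dotProduct, mulVec, Finset.mul_sum, mul_assoc]

theorem PosSemidef.of_tendsto {α : Type*} {l : Filter α} [l.NeBot] {F : α → Matrix ι ι ℝ}
    {M : Matrix ι ι ℝ} (hF : ∀ a, (F a).PosSemidef)
    (h : ∀ i j, Filter.Tendsto (fun a => F a i j) l (nhds (M i j))) : M.PosSemidef := by
  rw [posSemidef_real_iff_sum]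
  refine ⟨fun i j => ?_, fun x => ?_⟩
  · refine tendsto_nhds_unique (h i j) ((h j i).congr fun a => ?_)
    exact (posSemidef_real_iff_sum.1 (hF a)).1 j i
  · refine ge_of_tendsto' (tendsto_finsetSum _ fun i _ => tendsto_finsetSum _ fun j _ =>
      ((h i j).const_mul (x i)).mul_const (x j)) fun a => ?_
    exact (posSemidef_real_iff_sum.1 (hF a)).2 x

/-- The entrywise exponential minus one of a positive semidefinite matrix is positive
semidefinite. -/
theorem PosSemidef.map_exp_sub_one {A : Matrix ι ι ℝ} (hA : A.PosSemidef) :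
    (A.map fun r => Real.exp r - 1).PosSemidef := by
  refine PosSemidef.of_tendsto (l := Filter.atTop)
    (F := fun N : ℕ => ∑ k ∈ Finset.range N,
      ((k + 1).factorial : ℝ)⁻¹ • A.map (· ^ (k + 1))) (fun N => ?_) fun i j => ?_
  · exact posSemidef_sum _ fun k _ => (hA.map_pow_succ k).smul (by positivity)
  · have h : HasSum (fun k : ℕ => A i j ^ k / (k.factorial : ℝ)) (Real.exp (A i j)) := by
      rw [Real.exp_eq_exp_ℝ]
      exact NormedSpace.expSeries_div_hasSum_exp (A i j)
    have h' := ((hasSum_nat_add_iff' 1).2 h).tendsto_sum_nat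
    simp only [Finset.range_one, Finset.sum_singleton, pow_zero, Nat.factorial_zero,
      Nat.cast_one, div_one] at h'
    refine h'.congr fun N => ?_
    simp [Matrix.sum_apply, div_eq_inv_mul]

theorem PosSemidef.one_sub_exp_add_one_sub_exp_sub {G : Matrix ι ι ℝ} (hG : G.PosSemidef) :
    (Matrix.of fun i j => (1 - Real.exp (-G i i)) + (1 - Real.exp (-G j j)) -
      (1 - Real.exp (-(G i i + G j j - 2 * G i j)))).PosSemidef := by
  have h2 : ((2 : ℝ) • G).PosSemidef := hG.smul (by norm_num)
  have h := (posSemidef_vecMulVec_self_star fun i => 1 - Real.exp (-G i i)).add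
    ((posSemidef_vecMulVec_self_star fun i => Real.exp (-G i i)).hadamard h2.map_exp_sub_one)
  convert h using 1
  ext i j
  have : Real.exp (-(G i i + G j j - 2 * G i j)) =
      Real.exp (-G i i) * Real.exp (-G j j) * Real.exp (2 * G i j) := by
    rw [← Real.exp_add, ← Real.exp_add]
    ring_nf
  simp only [of_apply, this, add_apply, hadamard_apply, vecMulVec_apply, map_apply, smul_apply,
    smul_eq_mul, star_trivial]
  ring

end Matrix

section RpowIntegral

variable {γ : ℝ}

theorem integrableOn_one_sub_exp_mul_rpow (hγ : γ ∈ Ioo (0 : ℝ) 1) {x : ℝ} (hx : 0 ≤ x) :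
    IntegrableOn (fun s : ℝ => (1 - Real.exp (-(s * x))) * s ^ (-1 - γ)) (Ioi 0) := by
  have hm : Measurable fun s : ℝ => (1 - Real.exp (-(s * x))) * s ^ (-1 - γ) := by fun_prop
  have hnn : ∀ s : ℝ, 0 < s → 0 ≤ 1 - Real.exp (-(s * x)) := fun s hs =>
    sub_nonneg.2 (Real.exp_le_one_iff.2 (neg_nonpos.2 (by positivity)))
  rw [← Ioc_union_Ioi_eq_Ioi (zero_le_one (α := ℝ))]
  refine IntegrableOn.union ?_ ?_
  · have h : IntegrableOn (fun s : ℝ => x * s ^ (-γ)) (Ioc 0 1) := by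
      rw [← intervalIntegrable_iff_integrableOn_Ioc_of_le zero_le_one]
      exact (intervalIntegral.intervalIntegrable_rpow' (by linarith [hγ.2])).const_mul x
    refine h.mono' hm.aestronglyMeasurable ?_
    filter_upwards [ae_restrict_mem measurableSet_Ioc] with s hs
    have hs0 : 0 < s := hs.1
    rw [Real.norm_of_nonneg (mul_nonneg (hnn s hs0) (by positivity))]
    have h1 : 1 - Real.exp (-(s * x)) ≤ s * x := by
      linarith [Real.add_one_le_exp (-(s * x))]
    calc (1 - Real.exp (-(s * x))) * s ^ (-1 - γ) ≤ s * x * s ^ (-1 - γ) := by gcongr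
      _ = x * s ^ (-γ) := by
        have : s ^ (-γ) = s * s ^ (-1 - γ) := by
          rw [← Real.rpow_one_add' hs0.le (by linarith [hγ.1])]
          ring_nf
        rw [this]
        ring
  · have h : IntegrableOn (fun s : ℝ => s ^ (-1 - γ)) (Ioi 1) :=
      integrableOn_Ioi_rpow_of_lt (by linarith [hγ.1]) one_pos
    refine h.mono' hm.aestronglyMeasurable ?_
    filter_upwards [ae_restrict_mem measurableSet_Ioi] with s hs
    have hs0 : 0 < s := zero_lt_one.trans hs
    rw [Real.norm_of_nonneg (mul_nonneg (hnn s hs0) (by positivity))]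
    exact mul_le_of_le_one_left (by positivity) (by linarith [Real.exp_pos (-(s * x))])

theorem integral_one_sub_exp_mul_rpow (hγ : γ ∈ Ioo (0 : ℝ) 1) {x : ℝ} (hx : 0 ≤ x) :
    ∫ s in Ioi (0 : ℝ), (1 - Real.exp (-(s * x))) * s ^ (-1 - γ) =
      x ^ γ * ∫ s in Ioi (0 : ℝ), (1 - Real.exp (-s)) * s ^ (-1 - γ) := by
  rcases hx.eq_or_lt with rfl | hx
  · simp [Real.zero_rpow hγ.1.ne']
  have h := integral_comp_mul_left_Ioi (fun s : ℝ => (1 - Real.exp (-s)) * s ^ (-1 - γ)) 0 hx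
  rw [mul_zero, smul_eq_mul] at h
  have h' : ∫ s in Ioi (0 : ℝ), (1 - Real.exp (-(s * x))) * s ^ (-1 - γ) =
      x ^ (1 + γ) * ∫ s in Ioi (0 : ℝ), (1 - Real.exp (-(x * s))) * (x * s) ^ (-1 - γ) := by
    rw [← integral_const_mul]
    refine setIntegral_congr_fun measurableSet_Ioi fun s hs => ?_
    have hs0 : 0 < s := hs
    have : x ^ (1 + γ) * x ^ (-1 - γ) = 1 := by
      rw [← Real.rpow_add hx]
      simp
    simp only [mul_comm x s, Real.mul_rpow hs0.le hx.le]
    linear_combination -((1 - Real.exp (-(s * x))) * s ^ (-1 - γ)) * this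
  rw [h', h, ← mul_assoc, Real.rpow_add hx, Real.rpow_one]
  field_simp

theorem integral_one_sub_exp_neg_mul_rpow_pos (hγ : γ ∈ Ioo (0 : ℝ) 1) :
    0 < ∫ s in Ioi (0 : ℝ), (1 - Real.exp (-s)) * s ^ (-1 - γ) := by
  have hpos : ∀ s ∈ Ioi (0 : ℝ), 0 < (1 - Real.exp (-s)) * s ^ (-1 - γ) := fun s hs =>
    mul_pos (sub_pos.2 (Real.exp_lt_one_iff.2 (neg_neg_of_pos hs))) (Real.rpow_pos_of_pos hs _)
  rw [setIntegral_pos_iff_support_of_nonneg_ae]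
  · rw [inter_eq_self_of_subset_right fun s hs => Function.mem_support.2 (hpos s hs).ne']
    simp
  · filter_upwards [ae_restrict_mem measurableSet_Ioi] with s hs using (hpos s hs).le
  · simpa using integrableOn_one_sub_exp_mul_rpow hγ zero_le_one

end RpowIntegral

/-- The fractional Brownian motion covariance with Hurst index `γ` is positive semidefinite,
expressed in terms of the Gram matrix `G` of the points. -/
theorem Matrix.PosSemidef.rpow_add_rpow_sub_rpow {ι : Type*} [Fintype ι] {γ : ℝ}
    (hγ : γ ∈ Ioo (0 : ℝ) 1) {G : Matrix ι ι ℝ} (hG : G.PosSemidef)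
    (hd : ∀ i j, 0 ≤ G i i + G j j - 2 * G i j) :
    (Matrix.of fun i j =>
      G i i ^ γ + G j j ^ γ - (G i i + G j j - 2 * G i j) ^ γ).PosSemidef := by
  have hsymm := (posSemidef_real_iff_sum.1 hG).1
  refine posSemidef_real_iff_sum.2 ⟨fun i j => ?_, fun x => ?_⟩
  · simp only [of_apply, hsymm j i, add_comm (G j j), add_comm (G j j ^ γ)]
  set c := ∫ s in Ioi (0 : ℝ), (1 - Real.exp (-s)) * s ^ (-1 - γ)
  have hc0 : 0 < c := integral_one_sub_exp_neg_mul_rpow_pos hγ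
  set e : ℝ → ℝ → ℝ := fun y s => (1 - Real.exp (-(s * y))) * s ^ (-1 - γ) with he
  have hint : ∀ {y : ℝ}, 0 ≤ y → Integrable (e y) (volume.restrict (Ioi 0)) := fun hy =>
    integrableOn_one_sub_exp_mul_rpow hγ hy
  have heq : ∀ {y : ℝ}, 0 ≤ y → ∫ s in Ioi (0 : ℝ), e y s = y ^ γ * c := fun hy =>
    integral_one_sub_exp_mul_rpow hγ hy
  have hdiag : ∀ i, 0 ≤ G i i := fun i => hG.diag_nonneg
  have hintK : ∀ i j, Integrable (fun s => x i * (e (G i i) s + e (G j j) s -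
      e (G i i + G j j - 2 * G i j) s) * x j) (volume.restrict (Ioi 0)) := fun i j =>
    ((((hint (hdiag i)).add (hint (hdiag j))).sub (hint (hd i j))).const_mul _).mul_const _
  have key : (∑ i, ∑ j, x i * (G i i ^ γ + G j j ^ γ -
      (G i i + G j j - 2 * G i j) ^ γ) * x j) * c =
      ∫ s in Ioi (0 : ℝ), ∑ i, ∑ j, x i * (e (G i i) s + e (G j j) s -
        e (G i i + G j j - 2 * G i j) s) * x j := by
    rw [integral_finsetSum _ fun i _ => integrable_finsetSum _ fun j _ => hintK i j,
      Finset.sum_mul]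
    refine Finset.sum_congr rfl fun i _ => ?_
    rw [integral_finsetSum _ fun j _ => hintK i j, Finset.sum_mul]
    refine Finset.sum_congr rfl fun j _ => ?_
    have hadd : Integrable (fun s => e (G i i) s + e (G j j) s) (volume.restrict (Ioi 0)) :=
      (hint (hdiag i)).add (hint (hdiag j))
    rw [integral_mul_const, integral_const_mul, integral_sub hadd (hint (hd i j)),
      integral_add (hint (hdiag i)) (hint (hdiag j)), heq (hdiag i), heq (hdiag j),
      heq (hd i j)]
    ring
  refine nonneg_of_mul_nonneg_left (b := c) ?_ hc0
  simp only [of_apply]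
  rw [key]
  refine setIntegral_nonneg measurableSet_Ioi fun s hs => ?_
  have hs0 : 0 < s := hs
  have h := (posSemidef_real_iff_sum.1
    (hG.smul hs0.le).one_sub_exp_add_one_sub_exp_sub).2 x
  have h' := mul_nonneg h (Real.rpow_nonneg hs0.le (-1 - γ))
  refine h'.trans_eq ?_
  simp only [Finset.sum_mul, he, of_apply, smul_apply, smul_eq_mul]
  refine Finset.sum_congr rfl fun i _ => Finset.sum_congr rfl fun j _ => ?_
  rw [show s * G i i + s * G j j - 2 * (s * G i j) = s * (G i i + G j j - 2 * G i j) by ring]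
  ring

theorem mul_rpow_rpow_eq_sq {a t l γ : ℝ} (ha : 0 ≤ a) (ht : 0 ≤ t) :
    (a * t ^ l) ^ (1 / γ) = a ^ (1 / γ) * (t ^ (l / (2 * γ))) ^ 2 := by
  rw [Real.mul_rpow ha (Real.rpow_nonneg ht l), ← Real.rpow_mul ht, ← Real.rpow_natCast,
    ← Real.rpow_mul ht]
  congr 2
  push_cast
  rw [mul_one_div, div_mul_eq_mul_div, mul_comm l, mul_div_mul_left _ _ two_ne_zero]

/-- **The adaptive kernel is a valid covariance function.**
For any fidelity parameters `t¹,…,tⁿ ∈ [0,∞)^m`, the `n × n` matrix with entries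
`K_γ(tⁱ, tʲ)` is positive semidefinite. -/
theorem Kgamma_posSemidef (m n : ℕ) (γ : ℝ) (hγ : γ ∈ Set.Ioo (0 : ℝ) 1)
    (a l : Fin m → ℝ) (ha : ∀ j, 0 < a j) (hl : ∀ j, 0 < l j)
    (t : Fin n → (Fin m → ℝ)) (ht : ∀ i j, 0 ≤ t i j) :
    (Matrix.of fun i j => Kgamma m γ a l (t i) (t j)).PosSemidef := by
  set G : Matrix (Fin n) (Fin n) ℝ := ∑ k, a k ^ (1 / γ) •
    vecMulVec (fun i => t i k ^ (l k / (2 * γ))) (star fun i => t i k ^ (l k / (2 * γ))) with hGdef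
  have hG : G.PosSemidef := posSemidef_sum _ fun k _ =>
    (posSemidef_vecMulVec_self_star _).smul (Real.rpow_nonneg (ha k).le _)
  have hGapp : ∀ i j, G i j = ∑ k, a k ^ (1 / γ) *
      (t i k ^ (l k / (2 * γ)) * t j k ^ (l k / (2 * γ))) := fun i j => by
    simp [hGdef, Matrix.sum_apply, vecMulVec_apply]
  have hdiag : ∀ i, ∑ k, (a k * t i k ^ l k) ^ (1 / γ) = G i i := fun i => by
    rw [hGapp]
    refine Finset.sum_congr rfl fun k _ => ?_
    rw [mul_rpow_rpow_eq_sq (ha k).le (ht i k), sq]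
  have hdist : ∀ i j, ∑ k, a k ^ (1 / γ) *
      (t i k ^ (l k / (2 * γ)) - t j k ^ (l k / (2 * γ))) ^ 2 =
        G i i + G j j - 2 * G i j := fun i j => by
    simp only [hGapp, Finset.mul_sum, ← Finset.sum_add_distrib, ← Finset.sum_sub_distrib]
    exact Finset.sum_congr rfl fun k _ => by ring
  have h := (hG.rpow_add_rpow_sub_rpow hγ fun i j => by
    rw [← hdist]
    exact Finset.sum_nonneg fun k _ =>
      mul_nonneg (Real.rpow_nonneg (ha k).le _) (sq_nonneg _)).smul
    (show (0 : ℝ) ≤ 1 / 2 by norm_num)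
  convert h using 1
  ext i j
  simp only [Kgamma, hdiag, hdist, of_apply, Matrix.smul_apply, smul_eq_mul]
end
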